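/- The space V_p(λ) has the Banach-Saks property of type p (with weakly null sequences witnessed by norm-bounded coordinatewise-null sequences, as used in the proof): if (x_n) is a sequence in V_p(λ) with ‖x_n‖_{V_p(λ)} ≤ 1 for all n and x_n(j) → 0 as n → ∞ for every coordinate j, then there exists a strictly increasing sequence of indices (n_l) such that, setting b_l = x_{n_l}, one has ‖∑_{l=0}^{m} b_l‖_{V_p(λ)} ≤ 2(m+1)^{1/p} for all m ∈ ℕ. -/

import Mathlib

open Filter
open scoped BigOperators ENNReal

/-- The index window `I_k = {j ∈ ℤ : k - λ_k + 1 ≤ j ≤ k}` of the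
de la Vallée-Poussin mean (indices are positive integers). -/
noncomputable def vpWindow (lam : ℕ → ℝ) (k : ℕ) : Finset ℕ :=
  (Finset.Icc 1 k).filter fun j => (k : ℝ) - lam k + 1 ≤ (j : ℝ)

/-- The modular `ρ(x) = ∑_{k≥1} ((1/λ_k) ∑_{j ∈ I_k} |x_j|)^{p_k}`,
valued in `ℝ≥0∞` (so that `ρ(x) < ∞` is meaningful). -/
noncomputable def vpModular (lam pp : ℕ → ℝ) (x : ℕ → ℝ) : ℝ≥0∞ :=
  ∑' k : ℕ, ENNReal.ofReal
    (((lam (k + 1))⁻¹ * ∑ j ∈ vpWindow lam (k + 1), |x j|) ^ pp (k + 1))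

/-- For constant exponent `p`: `∑_{k≥1} ((1/λ_k) ∑_{j ∈ I_k} |x_j|)^p`, in `ℝ≥0∞`. -/
noncomputable def vpSum (lam : ℕ → ℝ) (p : ℝ) (x : ℕ → ℝ) : ℝ≥0∞ :=
  ∑' k : ℕ, ENNReal.ofReal
    (((lam (k + 1))⁻¹ * ∑ j ∈ vpWindow lam (k + 1), |x j|) ^ p)

/-- The norm of `V_p(λ)`. -/
noncomputable def vpNorm (lam : ℕ → ℝ) (p : ℝ) (x : ℕ → ℝ) : ℝ :=
  (vpSum lam p x).toReal ^ (1 / p)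

/-- A weighted version of convexity of `x ↦ x ^ p`: the weight on `b ^ p` may be taken close
to `1` at the price of a large weight on `a ^ p`. -/
theorem exists_rpow_add_le (p : ℝ) (hp : 1 ≤ p) :
    ∃ C : ℝ≥0∞, C ≠ ⊤ ∧ ∀ a b : ℝ≥0∞, (a + b) ^ p ≤ C * a ^ p + (1 + 2⁻¹) * b ^ p := by
  have hlim : Tendsto (fun w : ℝ≥0∞ => w * (w⁻¹) ^ p) (nhds 1) (nhds (1 * (1⁻¹) ^ p)) := by
    refine ENNReal.Tendsto.mul tendsto_id (by simp) ?_ (by simp)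
    exact (ENNReal.continuous_rpow_const.comp continuous_inv).tendsto 1
  have hlt : (1 : ℝ≥0∞) * (1⁻¹) ^ p < 1 + 2⁻¹ := by
    simpa using ENNReal.lt_add_right ENNReal.one_ne_top (by simp : (2⁻¹ : ℝ≥0∞) ≠ 0)
  have hev := (hlim.eventually (gt_mem_nhds hlt)).and (lt_mem_nhds (zero_lt_one' ℝ≥0∞))
  obtain ⟨w, hw1, hw, hw0⟩ :=
    ((eventually_mem_nhdsWithin (a := (1 : ℝ≥0∞)) (s := Set.Iio 1)).and
      (hev.filter_mono nhdsWithin_le_nhds)).exists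
  have hw1' : w < 1 := hw1
  have ht0 : 1 - w ≠ 0 := (tsub_pos_of_lt hw1').ne'
  have htt : 1 - w ≠ ⊤ := ENNReal.sub_ne_top ENNReal.one_ne_top
  have hp0 : 0 ≤ p := zero_le_one.trans hp
  refine ⟨(1 - w) * ((1 - w)⁻¹) ^ p, ENNReal.mul_ne_top htt
    (ENNReal.rpow_ne_top_of_nonneg hp0 (ENNReal.inv_ne_top.2 ht0)), fun a b => ?_⟩
  have h := ENNReal.rpow_arith_mean_le_arith_mean2_rpow (1 - w) w ((1 - w)⁻¹ * a) (w⁻¹ * b)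
    (tsub_add_cancel_of_le hw1'.le) hp
  rw [← mul_assoc, ← mul_assoc, ENNReal.mul_inv_cancel ht0 htt,
    ENNReal.mul_inv_cancel hw0.ne' hw1'.ne_top, one_mul, one_mul,
    ENNReal.mul_rpow_of_nonneg _ _ hp0, ENNReal.mul_rpow_of_nonneg _ _ hp0,
    ← mul_assoc, ← mul_assoc] at h
  exact h.trans (by gcongr)

/-- If `a n` is a coordinatewise null sequence in the unit ball of `ℓ^p`, then adding `a n` to a
fixed sequence eventually increases the `p`-th power sum by at most `2`. -/
theorem eventually_tsum_add_rpow_le {p : ℝ} (hp : 1 ≤ p) (f : ℕ → ℝ≥0∞) {a : ℕ → ℕ → ℝ≥0∞}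
    (ha : ∀ n, ∑' k, a n k ^ p ≤ 1) (ha0 : ∀ k, Tendsto (fun n => a n k) atTop (nhds 0)) :
    ∀ᶠ n in atTop, ∑' k, (f k + a n k) ^ p ≤ ∑' k, f k ^ p + 2 := by
  by_cases hf : ∑' k, f k ^ p = ⊤
  · simp [hf]
  obtain ⟨C, hC, hCle⟩ := exists_rpow_add_le p hp
  have h4 : (4⁻¹ : ℝ≥0∞) ≠ 0 := by simp
  have htail : Tendsto (fun N => C * ∑' k, f (k + N) ^ p) atTop (nhds 0) := by
    simpa using ENNReal.Tendsto.const_mul (ENNReal.tendsto_sum_nat_add (fun k => f k ^ p) hf)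
      (Or.inr hC)
  obtain ⟨N, hN⟩ := (htail.eventually (gt_mem_nhds (pos_iff_ne_zero.2 h4))).exists
  have hhead : Tendsto (fun n => ∑ k ∈ Finset.range N, (f k + a n k) ^ p) atTop
      (nhds (∑ k ∈ Finset.range N, f k ^ p)) := by
    refine tendsto_finsetSum _ fun k _ => ?_
    have h := (tendsto_const_nhds (x := f k)).add (ha0 k)
    rw [add_zero] at h
    exact (ENNReal.continuous_rpow_const.tendsto _).comp h
  have hle : ∑ k ∈ Finset.range N, f k ^ p ≤ ∑' k, f k ^ p := ENNReal.sum_le_tsum _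
  have hlt : ∑ k ∈ Finset.range N, f k ^ p < ∑' k, f k ^ p + 4⁻¹ :=
    hle.trans_lt (ENNReal.lt_add_right hf h4)
  filter_upwards [hhead.eventually (gt_mem_nhds hlt)] with n hn
  have hshift : ∑' k, (f (k + N) + a n (k + N)) ^ p ≤ 4⁻¹ + (1 + 2⁻¹) := by
    calc ∑' k, (f (k + N) + a n (k + N)) ^ p
        ≤ ∑' k, (C * f (k + N) ^ p + (1 + 2⁻¹) * a n (k + N) ^ p) :=
          ENNReal.tsum_le_tsum fun k => hCle _ _
      _ = C * ∑' k, f (k + N) ^ p + (1 + 2⁻¹) * ∑' k, a n (k + N) ^ p := by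
          rw [ENNReal.tsum_add, ENNReal.tsum_mul_left, ENNReal.tsum_mul_left]
      _ ≤ 4⁻¹ + (1 + 2⁻¹) * 1 := by
          gcongr
          exact (ENNReal.tsum_comp_le_tsum_of_injective (add_left_injective N)
            (fun k => a n k ^ p)).trans (ha n)
      _ = 4⁻¹ + (1 + 2⁻¹) := by rw [mul_one]
  have hsum : (4⁻¹ + (4⁻¹ + (1 + 2⁻¹)) : ℝ≥0∞) = 2 := by
    rw [← ENNReal.toReal_eq_toReal_iff' (by simp) (by simp)]
    rw [ENNReal.toReal_add (by simp) (by simp), ENNReal.toReal_add (by simp) (by simp),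
      ENNReal.toReal_add (by simp) (by simp)]
    norm_num
  calc ∑' k, (f k + a n k) ^ p
      = ∑ k ∈ Finset.range N, (f k + a n k) ^ p + ∑' k, (f (k + N) + a n (k + N)) ^ p :=
        (ENNReal.summable.sum_add_tsum_nat_add' (f := fun k => (f k + a n k) ^ p)).symm
    _ ≤ (∑' k, f k ^ p + 4⁻¹) + (4⁻¹ + (1 + 2⁻¹)) := add_le_add hn.le hshift
    _ = ∑' k, f k ^ p + 2 := by rw [add_assoc, hsum]

/-- The Banach–Saks property of type `p` for nonnegative coordinatewise null sequences in the
unit ball of `ℓ^p`. -/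
theorem exists_strictMono_tsum_sum_rpow_le {p : ℝ} (hp : 1 ≤ p) {a : ℕ → ℕ → ℝ≥0∞}
    (ha : ∀ n, ∑' k, a n k ^ p ≤ 1) (ha0 : ∀ k, Tendsto (fun n => a n k) atTop (nhds 0)) :
    ∃ nl : ℕ → ℕ, StrictMono nl ∧
      ∀ m : ℕ, ∑' k, (∑ l ∈ Finset.range m, a (nl l) k) ^ p ≤ 2 * m := by
  have hp0 : 0 < p := zero_lt_one.trans_le hp
  have hex : ∀ s : Finset ℕ, ∃ n, (∀ i ∈ s, i < n) ∧
      ∑' k, (∑ i ∈ s, a i k + a n k) ^ p ≤ ∑' k, (∑ i ∈ s, a i k) ^ p + 2 := fun s =>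
    (((Finset.eventually_all s).2 fun i _ => eventually_gt_atTop i).and
      (eventually_tsum_add_rpow_le hp (fun k => ∑ i ∈ s, a i k) ha ha0)).exists
  choose φ hφ hle using hex
  let S : ℕ → Finset ℕ := fun m => Nat.rec ∅ (fun _ s => insert (φ s) s) m
  have hS : ∀ m, S (m + 1) = insert (φ (S m)) (S m) := fun _ => rfl
  have hsum : ∀ m k, ∑ l ∈ Finset.range m, a (φ (S l)) k = ∑ i ∈ S m, a i k := by
    intro m k
    induction m with
    | zero => simp [S]
    | succ m ih =>
      rw [Finset.sum_range_succ, ih, hS,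
        Finset.sum_insert fun h => (hφ (S m) _ h).false, add_comm]
  refine ⟨fun m => φ (S m), strictMono_nat_of_lt_succ fun m => hφ _ _ ?_, fun m => ?_⟩
  · rw [hS]
    exact Finset.mem_insert_self _ _
  · induction m with
    | zero => simp [hp0]
    | succ m ih =>
      simp only [hsum] at ih
      simp only [Finset.sum_range_succ]
      simp only [hsum]
      refine (hle (S m)).trans ((add_le_add_left ih 2).trans_eq ?_)
      push_cast
      ring

/-- The mean of `|x|` over the window `I_{k+1}`, valued in `ℝ≥0∞`. -/
noncomputable def vpMean (lam : ℕ → ℝ) (x : ℕ → ℝ) (k : ℕ) : ℝ≥0∞ :=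
  ENNReal.ofReal ((lam (k + 1))⁻¹ * ∑ j ∈ vpWindow lam (k + 1), |x j|)

theorem vpSum_eq_tsum_vpMean_rpow {lam : ℕ → ℝ} (hlam : ∀ k : ℕ, 1 ≤ k → 0 < lam k) {p : ℝ}
    (hp : 0 ≤ p) (x : ℕ → ℝ) : vpSum lam p x = ∑' k, vpMean lam x k ^ p := by
  refine tsum_congr fun k => ?_
  have := hlam (k + 1) (by omega)
  rw [vpMean, ENNReal.ofReal_rpow_of_nonneg (by positivity) hp]

theorem vpMean_sum_le {lam : ℕ → ℝ} (hlam : ∀ k : ℕ, 1 ≤ k → 0 < lam k) {ι : Type*}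
    (s : Finset ι) (x : ι → ℕ → ℝ) (k : ℕ) :
    vpMean lam (∑ i ∈ s, x i) k ≤ ∑ i ∈ s, vpMean lam (x i) k := by
  have := hlam (k + 1) (by omega)
  simp only [vpMean]
  rw [← ENNReal.ofReal_sum_of_nonneg fun i _ => by positivity, ← Finset.mul_sum,
    Finset.sum_comm]
  gcongr with j
  rw [Finset.sum_apply]
  exact Finset.abs_sum_le_sum_abs _ _

theorem tendsto_vpMean_zero (lam : ℕ → ℝ) {xs : ℕ → ℕ → ℝ}
    (hxs : ∀ j : ℕ, 1 ≤ j → Tendsto (fun n => xs n j) atTop (nhds 0)) (k : ℕ) :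
    Tendsto (fun n => vpMean lam (xs n) k) atTop (nhds 0) := by
  have h : Tendsto (fun n => ∑ j ∈ vpWindow lam (k + 1), |xs n j|) atTop (nhds 0) := by
    rw [← Finset.sum_const_zero (s := vpWindow lam (k + 1))]
    refine tendsto_finsetSum _ fun j hj => ?_
    simpa using (hxs j (Finset.mem_Icc.1 (Finset.mem_filter.1 hj).1).1).abs
  simpa [vpMean] using ENNReal.tendsto_ofReal (h.const_mul (lam (k + 1))⁻¹)

/-- `V_p(λ)` has the Banach–Saks property of type `p` (weakly null sequences
witnessed by norm-bounded coordinatewise-null sequences). -/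
theorem vp_banachSaks_type_p (lam : ℕ → ℝ) (p : ℝ)
    (hlam1 : lam 1 = 1)
    (hlam_pos : ∀ k : ℕ, 1 ≤ k → 0 < lam k)
    (hlam_mono : ∀ k : ℕ, 1 ≤ k → lam k ≤ lam (k + 1))
    (hlam_step : ∀ k : ℕ, 1 ≤ k → lam (k + 1) ≤ lam k + 1)
    (hlam_top : Tendsto lam atTop atTop)
    (hp : 1 < p)
    (xs : ℕ → ℕ → ℝ) (hxs : ∀ n, vpSum lam p (xs n) < ⊤)
    (hxsB : ∀ n, vpNorm lam p (xs n) ≤ 1)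
    (hcoord : ∀ j : ℕ, 1 ≤ j → Tendsto (fun n => xs n j) atTop (nhds 0)) :
    ∃ nl : ℕ → ℕ, StrictMono nl ∧ ∀ m : ℕ,
      vpNorm lam p (∑ l ∈ Finset.range (m + 1), xs (nl l)) ≤
        2 * ((m : ℝ) + 1) ^ (1 / p) := by
  have hp0 : 0 < p := zero_lt_one.trans hp
  have hsum := vpSum_eq_tsum_vpMean_rpow hlam_pos hp0.le
  have hball : ∀ n, ∑' k, vpMean lam (xs n) k ^ p ≤ 1 := by
    intro n
    rw [← hsum, ← ENNReal.toReal_le_toReal (hxs n).ne ENNReal.one_ne_top, ENNReal.toReal_one]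
    by_contra! h
    exact (hxsB n).not_gt (Real.one_lt_rpow h (by positivity))
  obtain ⟨nl, hnl, hle⟩ :=
    exists_strictMono_tsum_sum_rpow_le hp.le hball (tendsto_vpMean_zero lam hcoord)
  refine ⟨nl, hnl, fun m => ?_⟩
  have hbound : vpSum lam p (∑ l ∈ Finset.range (m + 1), xs (nl l)) ≤ 2 * ((m + 1 : ℕ) : ℝ≥0∞) := by
    rw [hsum]
    refine le_trans (ENNReal.tsum_le_tsum fun k => ?_) (hle (m + 1))
    exact ENNReal.rpow_le_rpow (vpMean_sum_le hlam_pos _ (fun l => xs (nl l)) k) hp0.le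
  have hreal : (vpSum lam p (∑ l ∈ Finset.range (m + 1), xs (nl l))).toReal ≤ 2 * ((m : ℝ) + 1) := by
    refine (ENNReal.toReal_mono (by finiteness) hbound).trans_eq ?_
    rw [ENNReal.toReal_mul, ENNReal.toReal_natCast]
    simp
  calc vpNorm lam p (∑ l ∈ Finset.range (m + 1), xs (nl l))
      ≤ (2 * ((m : ℝ) + 1)) ^ (1 / p) :=
        Real.rpow_le_rpow ENNReal.toReal_nonneg hreal (by positivity)
    _ = 2 ^ (1 / p) * ((m : ℝ) + 1) ^ (1 / p) :=
        Real.mul_rpow (by norm_num) (by positivity)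
    _ ≤ 2 * ((m : ℝ) + 1) ^ (1 / p) := by
        gcongr
        refine Real.rpow_le_self_of_one_le (by norm_num) ?_
        rw [div_le_one hp0]
        exact hp.le
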